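/- Let (Y,d) be a complete separable metric space and let μ_n (n ∈ ℕ) and μ_∞ be Radon measures on Y, each finite on bounded sets, such that ∫ φ dμ_n → ∫ φ dμ_∞ for every bounded continuous function φ : Y → ℝ with bounded support. Let f_n : Y → ℝ ∪ {+∞} (n ∈ ℕ ∪ {∞}) be Borel functions such that whenever a sequence y_n → y in Y one has f_∞(y) ≤ liminf_{n→∞} f_n(y_n), and suppose there is a bounded continuous function g : Y → ℝ with bounded support such that f_n ≥ g for every n ∈ ℕ ∪ {∞}. Then ∫ f_∞ dμ_∞ ≤ liminf_{n→∞} ∫ f_n dμ_n. -/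

import Mathlib

open MeasureTheory Filter Set Topology
open scoped ENNReal NNReal

/-- The truncation of an extended real number to `[0, ∞]`. -/
noncomputable def erealToENNReal (x : EReal) : ℝ≥0∞ :=
  if x = ⊤ then ⊤ else ENNReal.ofReal x.toReal

/-- The integral of an `EReal`-valued function `f`, defined as
`∫ f⁺ dμ - ∫ f⁻ dμ` (with values in `EReal`).  When the negative part of `f` is
integrable (as is the case under the hypotheses of the theorem below, since `f`
is bounded from below by an integrable function), this is the natural extended
integral of a function with values in `ℝ ∪ {+∞}`. -/
noncomputable def erealIntegral {Y : Type*} [MeasurableSpace Y]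
    (μ : Measure Y) (f : Y → EReal) : EReal :=
  ((∫⁻ y, erealToENNReal (f y) ∂μ : ℝ≥0∞) : EReal) -
    ((∫⁻ y, erealToENNReal (-(f y)) ∂μ : ℝ≥0∞) : EReal)

theorem fv_integrable {Y : Type*} [MetricSpace Y] [TopologicalSpace.SeparableSpace Y]
    [MeasurableSpace Y] [BorelSpace Y] (μ : Measure Y)
    (hμ : ∀ s : Set Y, Bornology.IsBounded s → μ s < ∞)
    (g : Y → ℝ) (hgc : Continuous g) (hgb : ∃ Cb : ℝ, ∀ y, |g y| ≤ Cb)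
    (hgs : Bornology.IsBounded (Function.support g)) : Integrable g μ := by
  obtain ⟨C, hC⟩ := hgb
  rw [← integrableOn_iff_integrable_of_support_subset (subset_refl (Function.support g))]
  refine Measure.integrableOn_of_bounded (hμ _ hgs).ne
    hgc.measurable.aestronglyMeasurable (M := C) ?_
  exact Eventually.of_forall fun y => by simpa using hC y

theorem fv_eventually {Y : Type*} [MetricSpace Y] (h : ℕ → Y → ℝ≥0∞) (h' : Y → ℝ≥0∞)
    (hlsc : ∀ (y : Y) (ys : ℕ → Y), Tendsto ys atTop (𝓝 y) →
      h' y ≤ Filter.liminf (fun n => h n (ys n)) atTop)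
    (y : Y) (c : ℝ≥0∞) (hc : c < h' y) :
    ∀ᶠ p : ℕ × Y in atTop ×ˢ 𝓝 y, c < h p.1 p.2 := by
  by_contra hcon
  rw [not_eventually] at hcon
  obtain ⟨x, hx, hxc⟩ := exists_seq_forall_of_frequently hcon
  have hx1 : Tendsto (fun n => (x n).1) atTop atTop := tendsto_fst.comp hx
  have hx2 : Tendsto (fun n => (x n).2) atTop (𝓝 y) := tendsto_snd.comp hx
  obtain ⟨φ, hφ, hm⟩ := strictMono_subseq_of_tendsto_atTop hx1
  set m : ℕ → ℕ := (fun n => (x n).1) ∘ φ with hmdef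
  set z : ℕ → Y := fun k => (x (φ k)).2 with hz
  have hzt : Tendsto z atTop (𝓝 y) := hx2.comp hφ.tendsto_atTop
  set ys : ℕ → Y := Function.extend m z (fun _ => y) with hys
  have hyst : Tendsto ys atTop (𝓝 y) := by
    intro U hU
    have h1 : ∀ᶠ k in atTop, z k ∈ U := hzt hU
    obtain ⟨K, hK⟩ := eventually_atTop.1 h1
    refine eventually_atTop.2 ⟨m K, fun n hn => ?_⟩
    by_cases hex : ∃ k, m k = n
    · obtain ⟨k, rfl⟩ := hex
      have : ys (m k) = z k := hm.injective.extend_apply _ _ _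
      rw [this]
      exact hK k (hm.le_iff_le.1 hn)
    · have : ys n = y := Function.extend_apply' _ _ _ hex
      rw [this]
      exact mem_of_mem_nhds hU
  have h2 := hlsc y ys hyst
  have h3 : Filter.liminf (fun n => h n (ys n)) atTop ≤ c := by
    apply liminf_le_of_frequently_le'
    rw [frequently_atTop]
    intro a
    refine ⟨m a, hm.le_apply, ?_⟩
    have : ys (m a) = z a := hm.injective.extend_apply _ _ _
    rw [this]
    exact not_lt.1 (hxc (φ a))
  exact absurd (h2.trans h3) (not_le.2 hc)

/-- Lipschitz regularisation. -/
noncomputable def fvPhi {Y : Type*} [MetricSpace Y] (h : ℕ → Y → ℝ≥0∞) (k : ℕ) (y : Y) : ℝ :=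
  ⨅ p : {n : ℕ // k ≤ n} × Y, ((min (h p.1 p.2) k).toReal + k * dist y p.2)

theorem fvPhi_bdd {Y : Type*} [MetricSpace Y] (h : ℕ → Y → ℝ≥0∞) (k : ℕ) (y : Y) :
    BddBelow (range fun p : {n : ℕ // k ≤ n} × Y =>
      ((min (h p.1 p.2) k).toReal + k * dist y p.2)) :=
  ⟨0, by rintro _ ⟨p, rfl⟩; positivity⟩

theorem fvPhi_nonneg {Y : Type*} [MetricSpace Y] (h : ℕ → Y → ℝ≥0∞) (k : ℕ) (y : Y) :
    0 ≤ fvPhi h k y := Real.iInf_nonneg fun p => by positivity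

theorem fvPhi_le {Y : Type*} [MetricSpace Y] (h : ℕ → Y → ℝ≥0∞) (k n : ℕ) (hn : k ≤ n) (y : Y) :
    fvPhi h k y ≤ (min (h n y) k).toReal := by
  have := ciInf_le (fvPhi_bdd h k y) (⟨n, hn⟩, y)
  simpa [fvPhi] using this

theorem fvPhi_cont {Y : Type*} [MetricSpace Y] (h : ℕ → Y → ℝ≥0∞) (k : ℕ) :
    Continuous (fvPhi h k) := by
  refine (LipschitzWith.of_le_add_mul (k : ℝ≥0) fun x y => ?_).continuous
  have : Nonempty ({n : ℕ // k ≤ n} × Y) := ⟨(⟨k, le_rfl⟩, x)⟩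
  rw [← sub_le_iff_le_add]
  refine le_ciInf fun p => ?_
  have h1 := ciInf_le (fvPhi_bdd h k x) p
  have h2 := dist_triangle x y p.2
  have h3 : (k : ℝ) * dist x p.2 ≤ k * (dist x y + dist y p.2) := by gcongr
  have h4 : fvPhi h k x ≤ (min (h p.1 p.2) k).toReal + k * dist x p.2 := h1
  push_cast
  linarith

/-- Cutoff. -/
noncomputable def fvPsi {Y : Type*} [MetricSpace Y] (h : ℕ → Y → ℝ≥0∞) (y0 : Y) (k : ℕ)
    (y : Y) : ℝ := fvPhi h k y * max 0 (min 1 (k - dist y y0))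

theorem fvPsi_nonneg {Y : Type*} [MetricSpace Y] (h : ℕ → Y → ℝ≥0∞) (y0 : Y) (k : ℕ) (y : Y) :
    0 ≤ fvPsi h y0 k y := mul_nonneg (fvPhi_nonneg h k y) (le_max_left _ _)

theorem fvPsi_le {Y : Type*} [MetricSpace Y] (h : ℕ → Y → ℝ≥0∞) (y0 : Y) (k : ℕ) (y : Y) :
    fvPsi h y0 k y ≤ fvPhi h k y :=
  mul_le_of_le_one_right (fvPhi_nonneg h k y) (max_le zero_le_one (min_le_left _ _))

theorem fvPsi_cont {Y : Type*} [MetricSpace Y] (h : ℕ → Y → ℝ≥0∞) (y0 : Y) (k : ℕ) :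
    Continuous (fvPsi h y0 k) := by
  have := fvPhi_cont h k
  unfold fvPsi
  fun_prop

theorem fvPsi_bound {Y : Type*} [MetricSpace Y] (h : ℕ → Y → ℝ≥0∞) (y0 : Y) (k : ℕ) :
    ∃ C : ℝ, ∀ y, |fvPsi h y0 k y| ≤ C := by
  refine ⟨k, fun y => ?_⟩
  rw [abs_of_nonneg (fvPsi_nonneg h y0 k y)]
  refine (fvPsi_le h y0 k y).trans ((fvPhi_le h k k le_rfl y).trans ?_)
  have := ENNReal.toReal_mono (ENNReal.natCast_ne_top k) (min_le_right (h k y) (k : ℝ≥0∞))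
  simpa using this

theorem fvPsi_support {Y : Type*} [MetricSpace Y] (h : ℕ → Y → ℝ≥0∞) (y0 : Y) (k : ℕ) :
    Bornology.IsBounded (Function.support (fvPsi h y0 k)) := by
  refine (Metric.isBounded_ball (x := y0) (r := k)).subset fun y hy => ?_
  rw [Metric.mem_ball]
  by_contra hcon
  apply hy
  have : max 0 (min 1 ((k : ℝ) - dist y y0)) = 0 :=
    max_eq_left ((min_le_right _ _).trans (by linarith))
  simp [fvPsi, this]

theorem fvPsi_liminf {Y : Type*} [MetricSpace Y] (h : ℕ → Y → ℝ≥0∞) (h' : Y → ℝ≥0∞)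
    (hlsc : ∀ (y : Y) (ys : ℕ → Y), Tendsto ys atTop (𝓝 y) →
      h' y ≤ Filter.liminf (fun n => h n (ys n)) atTop) (y0 y : Y) :
    h' y ≤ Filter.liminf (fun k => ENNReal.ofReal (fvPsi h y0 k y)) atTop := by
  refine ENNReal.le_of_forall_nnreal_lt fun r hr => ?_
  have hev := fv_eventually h h' hlsc y r hr
  rw [(atTop_basis.prod Metric.nhds_basis_ball).eventually_iff] at hev
  obtain ⟨⟨N, ε⟩, ⟨-, hε⟩, hev⟩ := hev
  simp only at hε hev
  refine le_liminf_of_le (by isBoundedDefault) ?_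
  have e1 : ∀ᶠ k : ℕ in atTop, (r : ℝ) ≤ k :=
    tendsto_natCast_atTop_atTop.eventually_ge_atTop _
  have e2 : ∀ᶠ k : ℕ in atTop, (r : ℝ) / ε ≤ k :=
    tendsto_natCast_atTop_atTop.eventually_ge_atTop _
  have e3 : ∀ᶠ k : ℕ in atTop, dist y y0 + 1 ≤ k :=
    tendsto_natCast_atTop_atTop.eventually_ge_atTop _
  filter_upwards [e1, e2, e3, eventually_ge_atTop N] with k h1 h2 h3 h4
  have hχ : max 0 (min 1 ((k : ℝ) - dist y y0)) = 1 := by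
    rw [min_eq_left (by linarith)]; simp
  have hle : (r : ℝ) ≤ fvPsi h y0 k y := by
    rw [fvPsi, hχ, mul_one]
    have : Nonempty ({n : ℕ // k ≤ n} × Y) := ⟨(⟨k, le_rfl⟩, y)⟩
    refine le_ciInf fun p => ?_
    by_cases hd : dist y p.2 < ε
    · have h5 : (r : ℝ≥0∞) < h p.1 p.2 :=
        hev (x := ((p.1 : ℕ), p.2)) ⟨h4.trans p.1.2, by
          simpa [dist_comm] using hd⟩
      have h6 : (r : ℝ≥0∞) ≤ min (h p.1 p.2) k := le_min h5.le (by exact_mod_cast h1)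
      have h7 := ENNReal.toReal_mono (ne_top_of_le_ne_top (ENNReal.natCast_ne_top k)
        (min_le_right _ _)) h6
      have h8 : 0 ≤ (k : ℝ) * dist y p.2 := by positivity
      simp only [ENNReal.coe_toReal] at h7
      linarith
    · have h5 : (r : ℝ) ≤ k * ε := (div_le_iff₀ hε).1 h2
      have h6 : (k : ℝ) * ε ≤ k * dist y p.2 := by
        gcongr
        exact not_lt.1 hd
      have h7 : 0 ≤ (min (h p.1 p.2) (k : ℝ≥0∞)).toReal := by positivity
      linarith
  rw [← ENNReal.ofReal_coe_nnreal]
  exact ENNReal.ofReal_le_ofReal hle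

theorem fv_lintegral {Y : Type*} [MetricSpace Y]
    [TopologicalSpace.SeparableSpace Y] [MeasurableSpace Y] [BorelSpace Y]
    (μ : ℕ → Measure Y) (μ' : Measure Y)
    (hμ : ∀ n, ∀ s : Set Y, Bornology.IsBounded s → μ n s < ∞)
    (hμ' : ∀ s : Set Y, Bornology.IsBounded s → μ' s < ∞)
    (hweak : ∀ φ : Y → ℝ, Continuous φ → (∃ Cb : ℝ, ∀ y, |φ y| ≤ Cb) →
      Bornology.IsBounded (Function.support φ) →
      Tendsto (fun n => ∫ y, φ y ∂(μ n)) atTop (𝓝 (∫ y, φ y ∂μ')))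
    (h : ℕ → Y → ℝ≥0∞) (h' : Y → ℝ≥0∞)
    (hlsc : ∀ (y : Y) (ys : ℕ → Y), Tendsto ys atTop (𝓝 y) →
      h' y ≤ Filter.liminf (fun n => h n (ys n)) atTop) :
    ∫⁻ y, h' y ∂μ' ≤ Filter.liminf (fun n => ∫⁻ y, h n y ∂(μ n)) atTop := by
  rcases isEmpty_or_nonempty Y with hY | ⟨⟨y0⟩⟩
  · simp [Measure.eq_zero_of_isEmpty μ']
  have hk : ∀ k, ∫⁻ y, ENNReal.ofReal (fvPsi h y0 k y) ∂μ' ≤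
      Filter.liminf (fun n => ∫⁻ y, h n y ∂(μ n)) atTop := by
    intro k
    have hc := fvPsi_cont h y0 k
    have hb := fvPsi_bound h y0 k
    have hs := fvPsi_support h y0 k
    have hnn := fvPsi_nonneg h y0 k
    have ht := (ENNReal.continuous_ofReal.tendsto _).comp (hweak _ hc hb hs)
    rw [ofReal_integral_eq_lintegral_ofReal (fv_integrable μ' hμ' _ hc hb hs)
      (Eventually.of_forall hnn)] at ht
    rw [← ht.liminf_eq]
    refine liminf_le_liminf ?_
    filter_upwards [eventually_ge_atTop k] with n hn
    simp only [Function.comp]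
    rw [ofReal_integral_eq_lintegral_ofReal (fv_integrable (μ n) (hμ n) _ hc hb hs)
      (Eventually.of_forall hnn)]
    refine lintegral_mono fun y => ?_
    refine (ENNReal.ofReal_le_ofReal ((fvPsi_le h y0 k y).trans (fvPhi_le h k n hn y))).trans ?_
    exact ENNReal.ofReal_toReal_le.trans (min_le_left _ _)
  calc ∫⁻ y, h' y ∂μ' ≤ ∫⁻ y, Filter.liminf (fun k => ENNReal.ofReal (fvPsi h y0 k y)) atTop ∂μ' :=
        lintegral_mono fun y => fvPsi_liminf h h' hlsc y0 y
    _ ≤ Filter.liminf (fun k => ∫⁻ y, ENNReal.ofReal (fvPsi h y0 k y) ∂μ') atTop :=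
        lintegral_liminf_le fun k => (fvPsi_cont h y0 k).measurable.ennreal_ofReal
    _ ≤ _ := liminf_le_of_frequently_le' (Frequently.of_forall hk)

theorem fv_pointwise (x : EReal) (g : ℝ) (hx : (g : EReal) ≤ x) :
    erealToENNReal x + ENNReal.ofReal (-g) =
      (x + ((-g : ℝ) : EReal)).toENNReal + ENNReal.ofReal g + erealToENNReal (-x) := by
  change x.toENNReal + _ = _ + (-x).toENNReal
  induction x with
  | bot => simp at hx
  | top => simp
  | coe x =>
    have hx' : g ≤ x := by exact_mod_cast hx
    rw [← EReal.coe_add, ← EReal.coe_neg]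
    simp only [EReal.real_coe_toENNReal]
    have hp : ∀ a : ℝ, ENNReal.ofReal a = ENNReal.ofReal (max a 0) := fun a => by simp
    rw [hp x, hp (-g), hp g, hp (-x), ← ENNReal.ofReal_add (by positivity) (by positivity),
      ← ENNReal.ofReal_add (by linarith) (by positivity),
      ← ENNReal.ofReal_add (add_nonneg (by linarith) (by positivity)) (by positivity)]
    congr 1
    have e1 := max_zero_sub_max_neg_zero_eq_self x
    have e2 := max_zero_sub_max_neg_zero_eq_self g
    linarith

theorem fv_integral {Y : Type*} [MetricSpace Y]
    [TopologicalSpace.SeparableSpace Y] [MeasurableSpace Y] [BorelSpace Y]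
    (μ : Measure Y) (f : Y → EReal) (hf : Measurable f) (g : Y → ℝ) (hgc : Continuous g)
    (hgi : Integrable g μ) (hgf : ∀ y, (g y : EReal) ≤ f y) :
    erealIntegral μ f = ((∫⁻ y, (f y + ((-g y : ℝ) : EReal)).toENNReal ∂μ : ℝ≥0∞) : EReal) +
      ((∫ y, g y ∂μ : ℝ) : EReal) := by
  have hfm' : Measurable fun y => erealToENNReal (f y) :=
    EReal.continuous_toENNReal.measurable.comp hf
  have hGm : Measurable fun y => ENNReal.ofReal (g y) := hgc.measurable.ennreal_ofReal
  have hGm' : Measurable fun y => ENNReal.ofReal (-g y) := hgc.measurable.neg.ennreal_ofReal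
  have hfn : Measurable fun y => erealToENNReal (-f y) :=
    EReal.continuous_toENNReal.measurable.comp (continuous_neg.measurable.comp hf)
  have key : ∫⁻ y, erealToENNReal (f y) ∂μ + ∫⁻ y, ENNReal.ofReal (-g y) ∂μ =
      ∫⁻ y, (f y + ((-g y : ℝ) : EReal)).toENNReal ∂μ + ∫⁻ y, ENNReal.ofReal (g y) ∂μ +
        ∫⁻ y, erealToENNReal (-f y) ∂μ := by
    rw [← lintegral_add_left hfm', ← lintegral_add_right _ hGm, ← lintegral_add_right _ hfn]
    exact lintegral_congr fun y => fv_pointwise _ _ (hgf y)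
  have hG : ∫⁻ y, ENNReal.ofReal (g y) ∂μ ≠ ⊤ := hgi.lintegral_lt_top.ne
  have hG' : ∫⁻ y, ENNReal.ofReal (-g y) ∂μ ≠ ⊤ := hgi.neg.lintegral_lt_top.ne
  have hB : ∫⁻ y, erealToENNReal (-f y) ∂μ ≠ ⊤ := by
    refine ne_top_of_le_ne_top hG' (lintegral_mono fun y => ?_)
    exact EReal.toENNReal_le_toENNReal (y := ((-g y : ℝ) : EReal)) (by
      rw [EReal.coe_neg]; exact EReal.neg_le_neg_iff.2 (hgf y))
  rw [integral_eq_lintegral_pos_part_sub_lintegral_neg_part hgi, erealIntegral]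
  generalize (∫⁻ y, erealToENNReal (f y) ∂μ) = A at *
  generalize (∫⁻ y, erealToENNReal (-f y) ∂μ) = B at *
  generalize (∫⁻ y, ENNReal.ofReal (g y) ∂μ) = G at *
  generalize (∫⁻ y, ENNReal.ofReal (-g y) ∂μ) = G' at *
  generalize (∫⁻ y, (f y + ((-g y : ℝ) : EReal)).toENNReal ∂μ) = H at *
  lift B to ℝ≥0 using hB
  lift G to ℝ≥0 using hG
  lift G' to ℝ≥0 using hG'
  by_cases hA : A = ⊤
  · have hH : H = ⊤ := by
      by_contra hH
      lift H to ℝ≥0 using hH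
      rw [hA, top_add] at key
      exact absurd key.symm (by simp)
    rw [hA, hH]
    rfl
  · lift A to ℝ≥0 using hA
    have hH : H ≠ ⊤ := by
      rintro rfl
      rw [top_add, top_add] at key
      exact absurd key (by simp)
    lift H to ℝ≥0 using hH
    have k2 : (A : ℝ) + G' = H + G + B := by exact_mod_cast key
    have : ((A : ℝ) : EReal) - ((B : ℝ) : EReal) = ((H : ℝ) : EReal) + ((G - G' : ℝ) : EReal) := by
      rw [← EReal.coe_sub, ← EReal.coe_add]
      congr 1
      linarith
    exact this

/-- **A variant of Fatou's lemma.**  Let `Y` be a complete separable metric space,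
`μ n` (`n ∈ ℕ`) and `μ'` Borel measures on `Y` finite on bounded sets such that
`∫ φ dμ n → ∫ φ dμ'` for every bounded continuous `φ : Y → ℝ` with bounded support.
Let `f n : Y → ℝ ∪ {+∞}` (`n ∈ ℕ ∪ {∞}`, with `f ∞` written `f'`) be Borel functions
such that `f' y ≤ liminf_n (f n y_n)` whenever `y_n → y`, all bounded from below by
a bounded continuous function `g` with bounded support.
Then `∫ f' dμ' ≤ liminf_n ∫ (f n) d(μ n)`. -/
theorem fatou_variant {Y : Type*} [MetricSpace Y] [CompleteSpace Y]
    [TopologicalSpace.SeparableSpace Y] [MeasurableSpace Y] [BorelSpace Y]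
    (μ : ℕ → Measure Y) (μ' : Measure Y)
    (hμ : ∀ n, ∀ s : Set Y, Bornology.IsBounded s → μ n s < ∞)
    (hμ' : ∀ s : Set Y, Bornology.IsBounded s → μ' s < ∞)
    (hweak : ∀ φ : Y → ℝ, Continuous φ → (∃ Cb : ℝ, ∀ y, |φ y| ≤ Cb) →
      Bornology.IsBounded (Function.support φ) →
      Tendsto (fun n => ∫ y, φ y ∂(μ n)) atTop (𝓝 (∫ y, φ y ∂μ')))
    (f : ℕ → Y → EReal) (f' : Y → EReal)
    (hfm : ∀ n, Measurable (f n)) (hf'm : Measurable f')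
    (hlsc : ∀ (y : Y) (ys : ℕ → Y), Tendsto ys atTop (𝓝 y) →
      f' y ≤ Filter.liminf (fun n => f n (ys n)) atTop)
    (g : Y → ℝ) (hgc : Continuous g) (hgb : ∃ Cb : ℝ, ∀ y, |g y| ≤ Cb)
    (hgs : Bornology.IsBounded (Function.support g))
    (hgf : ∀ n y, (g y : EReal) ≤ f n y) (hgf' : ∀ y, (g y : EReal) ≤ f' y) :
    erealIntegral μ' f' ≤ Filter.liminf (fun n => erealIntegral (μ n) (f n)) atTop := by
  have hgi' := fv_integrable μ' hμ' g hgc hgb hgs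
  have hgi := fun n => fv_integrable (μ n) (hμ n) g hgc hgb hgs
  rw [fv_integral μ' f' hf'm g hgc hgi' hgf']
  simp_rw [fun n => fv_integral (μ n) (f n) (hfm n) g hgc (hgi n) (hgf n)]
  have hmain := fv_lintegral μ μ' hμ hμ' hweak
    (fun n y => (f n y + ((-g y : ℝ) : EReal)).toENNReal)
    (fun y => (f' y + ((-g y : ℝ) : EReal)).toENNReal) (by
      intro y ys hys
      have hmono : Monotone EReal.toENNReal := fun _ _ h => EReal.toENNReal_le_toENNReal h
      have h1 := hmono.map_liminf_of_continuousAt (F := atTop)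
        (fun n => f n (ys n) + ((-g (ys n) : ℝ) : EReal))
        EReal.continuous_toENNReal.continuousAt
      refine le_trans (hmono ?_) h1.le
      have h2 : Tendsto (fun n => ((-g (ys n) : ℝ) : EReal)) atTop (𝓝 ((-g y : ℝ) : EReal)) :=
        (continuous_coe_real_ereal.tendsto _).comp
          ((hgc.neg.tendsto y).comp hys)
      rw [← h2.liminf_eq]
      exact (add_le_add_left (hlsc y ys hys) _).trans EReal.le_liminf_add)
  have hmono : Monotone ((↑) : ℝ≥0∞ → EReal) := fun _ _ h => EReal.coe_ennreal_le_coe_ennreal_iff.2 h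
  have h1 := hmono.map_liminf_of_continuousAt (F := atTop)
    (fun n => ∫⁻ y, (f n y + ((-g y : ℝ) : EReal)).toENNReal ∂(μ n))
    continuous_coe_ennreal_ereal.continuousAt
  have h2 : Tendsto (fun n => ((∫ y, g y ∂(μ n) : ℝ) : EReal)) atTop
      (𝓝 ((∫ y, g y ∂μ' : ℝ) : EReal)) :=
    (continuous_coe_real_ereal.tendsto _).comp (hweak g hgc hgb hgs)
  rw [← h2.liminf_eq]
  exact (add_le_add_left ((hmono hmain).trans h1.le) _).trans EReal.le_liminf_add
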